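/- arXiv:1805.01999 — 3 statements merged into one kernel-verified Lean document; each statement's English description precedes it below -/
import Mathlib

section
/- Let 0<q<1. The function f(x) = log Γ_q(x) + x·ψ_q(x) is strictly increasing on (1,∞) and has a unique zero, which lies in the interval (1,2). -/
open Real

/-- The q-digamma function: ψ_q(x) = -log(1-q) + (log q)·∑_{n=1}^∞ q^{nx}/(1-q^n). -/
noncomputable def qDigamma (q x : ℝ) : ℝ :=
  -Real.log (1 - q) + Real.log q * ∑' n : ℕ, q ^ (((n : ℝ) + 1) * x) / (1 - q ^ (n + 1))

/-- The q-gamma function: Γ_q(x) = (q;q)_∞/(q^x;q)_∞ · (1-q)^{1-x}. -/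
noncomputable def qGamma (q x : ℝ) : ℝ :=
  ((∏' i : ℕ, (1 - q ^ (i + 1))) / ∏' i : ℕ, (1 - q ^ (x + (i : ℝ)))) * (1 - q) ^ (1 - x)

/-- The q-bracket: [x]_q = (1-q^x)/(1-q). -/
noncomputable def qBracket (q x : ℝ) : ℝ := (1 - q ^ x) / (1 - q)

lemma qg_pow_lt (q : ℝ) (hq0 : 0 < q) (hq1 : q < 1) (n : ℕ) : q ^ (n + 1) < 1 :=
  pow_lt_one₀ hq0.le hq1 (Nat.succ_ne_zero n)

lemma qg_pow_le (q : ℝ) (hq0 : 0 < q) (hq1 : q < 1) (n : ℕ) : q ^ (n + 1) ≤ q :=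
  pow_le_of_le_one hq0.le hq1.le (Nat.succ_ne_zero n)

lemma qg_rpow_eq (q : ℝ) (hq0 : 0 < q) (n : ℕ) (x : ℝ) :
    q ^ (((n : ℝ) + 1) * x) = (q ^ x) ^ (n + 1) := by
  rw [mul_comm, Real.rpow_mul hq0.le, ← Real.rpow_natCast]
  push_cast
  rfl

lemma qg_summable_B (q : ℝ) (hq0 : 0 < q) (hq1 : q < 1) (x : ℝ) (hx : 0 < x) :
    Summable (fun n : ℕ => q ^ (((n : ℝ) + 1) * x) / (1 - q ^ (n + 1))) := by
  have h1 : q ^ x < 1 := Real.rpow_lt_one hq0.le hq1 hx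
  have h0 : 0 < q ^ x := Real.rpow_pos_of_pos hq0 x
  have hs : Summable (fun n : ℕ => (q ^ x) ^ (n + 1) / (1 - q)) :=
    ((summable_nat_add_iff 1).2 (summable_geometric_of_lt_one h0.le h1)).div_const _
  refine Summable.of_nonneg_of_le (fun n => ?_) (fun n => ?_) hs
  · have := qg_pow_lt q hq0 hq1 n
    have h2 : 0 < 1 - q ^ (n + 1) := by linarith
    positivity
  · rw [qg_rpow_eq q hq0]
    have := qg_pow_le q hq0 hq1 n
    have h2 : 0 < 1 - q := by linarith
    gcongr

lemma qg_summable_C (q : ℝ) (hq0 : 0 < q) (hq1 : q < 1) (x : ℝ) (hx : 0 < x) :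
    Summable (fun n : ℕ => q ^ (((n : ℝ) + 1) * x) / (((n : ℝ) + 1) * (1 - q ^ (n + 1)))) := by
  refine Summable.of_nonneg_of_le (fun n => ?_) (fun n => ?_) (qg_summable_B q hq0 hq1 x hx)
  · have := qg_pow_lt q hq0 hq1 n
    have h2 : 0 < 1 - q ^ (n + 1) := by linarith
    positivity
  · have := qg_pow_lt q hq0 hq1 n
    have h2 : 0 < 1 - q ^ (n + 1) := by linarith
    have h3 : (0 : ℝ) ≤ n := Nat.cast_nonneg n
    have h4 : 0 < q ^ (((n : ℝ) + 1) * x) := Real.rpow_pos_of_pos hq0 _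
    gcongr
    nlinarith

lemma qg_log_prod (q : ℝ) (hq0 : 0 < q) (hq1 : q < 1) (x : ℝ) (hx : 0 < x) :
    0 < ∏' i : ℕ, (1 - q ^ (x + (i : ℝ))) ∧
    Real.log (∏' i : ℕ, (1 - q ^ (x + (i : ℝ)))) =
      - ∑' n : ℕ, q ^ (((n : ℝ) + 1) * x) / (((n : ℝ) + 1) * (1 - q ^ (n + 1))) := by
  let F : ℕ × ℕ → ℝ := fun p => q ^ (((p.1 : ℝ) + 1) * (x + (p.2 : ℝ))) / ((p.1 : ℝ) + 1)
  have hF0 : 0 ≤ F := fun p => by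
    have : 0 < q ^ (((p.1 : ℝ) + 1) * (x + (p.2 : ℝ))) := Real.rpow_pos_of_pos hq0 _
    show 0 ≤ q ^ (((p.1 : ℝ) + 1) * (x + (p.2 : ℝ))) / ((p.1 : ℝ) + 1)
    positivity
  have hrow : ∀ n : ℕ, HasSum (fun i : ℕ => F (n, i))
      (q ^ (((n : ℝ) + 1) * x) / (((n : ℝ) + 1) * (1 - q ^ (n + 1)))) := by
    intro n
    have h1 := qg_pow_lt q hq0 hq1 n
    have h := (hasSum_geometric_of_lt_one (by positivity) h1).mul_left
      (q ^ (((n : ℝ) + 1) * x) / ((n : ℝ) + 1))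
    have ef : (fun i : ℕ => F (n, i)) =
        fun i : ℕ => q ^ (((n : ℝ) + 1) * x) / ((n : ℝ) + 1) * (q ^ (n + 1)) ^ i := by
      funext i
      simp only [F]
      rw [mul_add, Real.rpow_add hq0, qg_rpow_eq q hq0 n (i : ℝ), Real.rpow_natCast, ← pow_mul,
        ← pow_mul, mul_comm i]
      ring
    rw [ef, div_mul_eq_div_div, div_eq_mul_inv _ (1 - _)]
    exact h
  have hC := qg_summable_C q hq0 hq1 x hx
  have hFs : Summable F := by
    rw [summable_prod_of_nonneg hF0]
    refine ⟨fun n => (hrow n).summable, ?_⟩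
    simpa only [fun n => (hrow n).tsum_eq] using hC
  have htot : ∑' p, F p
      = ∑' n : ℕ, q ^ (((n : ℝ) + 1) * x) / (((n : ℝ) + 1) * (1 - q ^ (n + 1))) :=
    (hFs.hasSum.prod_fiberwise hrow).tsum_eq.symm
  have hlt : ∀ i : ℕ, q ^ (x + (i : ℝ)) < 1 := fun i =>
    Real.rpow_lt_one hq0.le hq1 (by positivity)
  have hcol : ∀ i : ℕ, HasSum (fun n : ℕ => F (n, i)) (-Real.log (1 - q ^ (x + (i : ℝ)))) := by
    intro i
    have h := Real.hasSum_pow_div_log_of_abs_lt_one (x := q ^ (x + (i : ℝ)))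
      (by rw [abs_of_pos (Real.rpow_pos_of_pos hq0 _)]; exact hlt i)
    convert h using 1
    funext n
    simp only [F]
    rw [qg_rpow_eq q hq0]
  have hsw : HasSum (F ∘ Prod.swap) (∑' p, F p) :=
    (Equiv.prodComm ℕ ℕ).hasSum_iff.2 hFs.hasSum
  have hlog : HasSum (fun i : ℕ => -Real.log (1 - q ^ (x + (i : ℝ)))) (∑' p, F p) :=
    hsw.prod_fiberwise hcol
  have hlog2 : HasSum (fun i : ℕ => Real.log (1 - q ^ (x + (i : ℝ)))) (-∑' p, F p) := by
    simpa using hlog.neg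
  have hp := Real.rexp_tsum_eq_tprod (f := fun i : ℕ => 1 - q ^ (x + (i : ℝ)))
    (fun i => by have := hlt i; linarith) hlog2.summable
  rw [hlog2.tsum_eq] at hp
  rw [← hp, Real.log_exp, htot]
  exact ⟨Real.exp_pos _, rfl⟩

/-- termwise summand -/
noncomputable def qgTerm (q : ℝ) (n : ℕ) (x : ℝ) : ℝ :=
  q ^ (((n : ℝ) + 1) * x) / (((n : ℝ) + 1) * (1 - q ^ (n + 1)))
    - q ^ (n + 1) / (((n : ℝ) + 1) * (1 - q ^ (n + 1)))
    + (x - 1) * (q ^ (n + 1) / ((n : ℝ) + 1))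
    + x * (q ^ (n + 1) / ((n : ℝ) + 1)
      + Real.log q * (q ^ (((n : ℝ) + 1) * x) / (1 - q ^ (n + 1))))

lemma qg_hasSum (q : ℝ) (hq0 : 0 < q) (hq1 : q < 1) (x : ℝ) (hx : 0 < x) :
    HasSum (fun n => qgTerm q n x) (Real.log (qGamma q x) + x * qDigamma q x) := by
  have hA := Real.hasSum_pow_div_log_of_abs_lt_one (x := q) (by rwa [abs_of_pos hq0])
  have hB := (qg_summable_B q hq0 hq1 x hx).hasSum
  have hC := (qg_summable_C q hq0 hq1 x hx).hasSum
  have hC1 := (qg_summable_C q hq0 hq1 1 one_pos).hasSum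
  have e1 : ∀ n : ℕ, q ^ (((n : ℝ) + 1) * 1) = q ^ (n + 1) := fun n => by
    rw [qg_rpow_eq q hq0, Real.rpow_one]
  have e2 : ∀ i : ℕ, q ^ (1 + (i : ℝ)) = q ^ (i + 1) := fun i => by
    rw [← Real.rpow_natCast]; push_cast; rw [add_comm]
  obtain ⟨p1, l1⟩ := qg_log_prod q hq0 hq1 1 one_pos
  obtain ⟨p, l⟩ := qg_log_prod q hq0 hq1 x hx
  simp only [e1, e2] at hC1 p1 l1
  have h := ((hC.sub hC1).add (hA.mul_left (x - 1))).add
    ((hA.add (hB.mul_left (Real.log q))).mul_left x)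
  have hq : 0 < 1 - q := by linarith
  have key : ∀ {g : ℕ → ℝ} {a b : ℝ}, HasSum g a → b = a → HasSum g b :=
    fun hg hab => hab ▸ hg
  refine key h ?_
  unfold qGamma qDigamma
  rw [Real.log_mul (div_pos p1 p).ne' (Real.rpow_pos_of_pos hq _).ne',
    Real.log_div p1.ne' p.ne', Real.log_rpow hq, l1, l]
  ring

lemma qg_exp_lt (t : ℝ) (ht : 0 < t) : Real.exp (-t) < 1 - t + t ^ 2 / 2 := by
  have h := Real.quadratic_le_exp_of_nonneg ht.le
  have h2 : Real.exp (-t) * Real.exp t = 1 := by rw [← Real.exp_add]; simp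
  have h3 := Real.exp_pos (-t)
  have h5 : Real.exp (-t) * (1 + t + t ^ 2 / 2) ≤ 1 := by nlinarith
  have h6 : (1 - t + t ^ 2 / 2) * (1 + t + t ^ 2 / 2) = 1 + t ^ 4 / 4 := by ring
  have h7 : 0 < t ^ 4 := by positivity
  by_contra hc
  push Not at hc
  have h8 : 0 < 1 + t + t ^ 2 / 2 := by positivity
  nlinarith [mul_le_mul_of_nonneg_right hc h8.le]

lemma qg_key (t x : ℝ) (ht : 0 < t) (hx : 1 ≤ x) :
    0 < 2 * Real.exp (-t) * (1 - Real.exp (-t)) + Real.exp (-(t * x)) * (x * t ^ 2 - 2 * t) := by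
  have h1 : 0 < 1 - Real.exp (-t) := by
    have : Real.exp (-t) < 1 := (by rw [← Real.exp_zero]; exact Real.exp_lt_exp.2 (by linarith))
    linarith
  have h0 := Real.exp_pos (-t)
  have h2 := Real.exp_pos (-(t * x))
  rcases le_total 2 (t * x) with h | h
  · have : 0 ≤ x * t ^ 2 - 2 * t := by nlinarith
    positivity
  · have h3 : Real.exp (-(t * x)) ≤ Real.exp (-t) := Real.exp_le_exp.2 (by nlinarith)
    have h4 := qg_exp_lt t ht
    have h5 : 0 ≤ 2 * t - x * t ^ 2 := by nlinarith
    have h6 := mul_le_mul_of_nonneg_right h3 h5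
    have h7 : 2 * t - x * t ^ 2 ≤ 2 * t - t ^ 2 := by nlinarith [sq_nonneg t]
    have h8 := mul_le_mul_of_nonneg_left h7 h0.le
    have h9 : 0 < Real.exp (-t) * (2 * (1 - Real.exp (-t)) - (2 * t - t ^ 2)) :=
      mul_pos h0 (by linarith)
    nlinarith

lemma qg_hasDeriv (q : ℝ) (hq0 : 0 < q) (n : ℕ) (x : ℝ) :
    HasDerivAt (qgTerm q n)
      (q ^ (((n : ℝ) + 1) * x) * (Real.log q * ((n : ℝ) + 1)) / (((n : ℝ) + 1) * (1 - q ^ (n + 1)))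
      + 1 * (q ^ (n + 1) / ((n : ℝ) + 1))
      + (1 * (q ^ (n + 1) / ((n : ℝ) + 1)
        + Real.log q * (q ^ (((n : ℝ) + 1) * x) / (1 - q ^ (n + 1))))
      + x * (Real.log q * (q ^ (((n : ℝ) + 1) * x) * (Real.log q * ((n : ℝ) + 1))
        / (1 - q ^ (n + 1)))))) x := by
  have hr : HasDerivAt (fun x : ℝ => q ^ (((n : ℝ) + 1) * x))
      (q ^ (((n : ℝ) + 1) * x) * (Real.log q * ((n : ℝ) + 1))) x := by
    have h := ((hasDerivAt_id x).const_mul ((n : ℝ) + 1)).const_rpow hq0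
    have e : q ^ (((n : ℝ) + 1) * x) * (Real.log q * ((n : ℝ) + 1))
        = Real.log q * (((n : ℝ) + 1) * 1) * q ^ (((n : ℝ) + 1) * x) := by ring
    rw [e]
    exact h
  exact (((hr.div_const _).sub_const _).add (((hasDerivAt_id x).sub_const 1).mul_const _)).add
    ((hasDerivAt_id x).mul (((hr.div_const _).const_mul (Real.log q)).const_add _))

lemma qg_exps (q : ℝ) (hq0 : 0 < q) (hq1 : q < 1) (n : ℕ) :
    ∃ t : ℝ, 0 < t ∧ Real.log q = - (t / ((n : ℝ) + 1)) ∧ q ^ (n + 1) = Real.exp (-t) ∧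
      ∀ x : ℝ, q ^ (((n : ℝ) + 1) * x) = Real.exp (-(t * x)) := by
  have hl := Real.log_neg hq0 hq1
  have hn : (0 : ℝ) < (n : ℝ) + 1 := by positivity
  refine ⟨-(Real.log q * ((n : ℝ) + 1)), by nlinarith, by field_simp, ?_, fun x => ?_⟩
  · rw [← Real.rpow_natCast, Real.rpow_def_of_pos hq0]
    push_cast
    ring_nf
  · rw [Real.rpow_def_of_pos hq0]
    ring_nf

lemma qg_strictMono (q : ℝ) (hq0 : 0 < q) (hq1 : q < 1) (n : ℕ) :
    StrictMonoOn (qgTerm q n) (Set.Ici 1) := by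
  refine strictMonoOn_of_deriv_pos (convex_Ici 1)
    (fun x _ => (qg_hasDeriv q hq0 n x).continuousAt.continuousWithinAt) (fun x hx => ?_)
  rw [interior_Ici] at hx
  rw [(qg_hasDeriv q hq0 n x).deriv]
  obtain ⟨t, ht, e1, e2, e3⟩ := qg_exps q hq0 hq1 n
  have hn : (0 : ℝ) < (n : ℝ) + 1 := by positivity
  have hk := qg_key t x ht (le_of_lt hx)
  have h1 := qg_pow_lt q hq0 hq1 n
  rw [e3, e1]
  rw [e2] at h1 ⊢
  have h2 : 0 < 1 - Real.exp (-t) := by linarith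
  have := div_pos hk (mul_pos hn h2)
  refine this.trans_eq ?_
  field_simp
  ring

lemma qg_one (q : ℝ) (hq0 : 0 < q) (hq1 : q < 1) (n : ℕ) : qgTerm q n 1 < 0 := by
  unfold qgTerm
  obtain ⟨t, ht, e1, e2, e3⟩ := qg_exps q hq0 hq1 n
  have hn : (0 : ℝ) < (n : ℝ) + 1 := by positivity
  have h1 := qg_pow_lt q hq0 hq1 n
  rw [e3, e1]
  rw [e2] at h1 ⊢
  have h2 : 0 < 1 - Real.exp (-t) := by linarith
  have h3 : -t + 1 < Real.exp (-t) := Real.add_one_lt_exp (by linarith)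
  have hk : 0 < Real.exp (-t) * (t - (1 - Real.exp (-t))) :=
    mul_pos (Real.exp_pos _) (by linarith)
  have := div_pos hk (mul_pos hn h2)
  rw [← neg_pos]
  refine this.trans_eq ?_
  rw [mul_one]
  field_simp
  ring

lemma qg_two (q : ℝ) (hq0 : 0 < q) (hq1 : q < 1) (n : ℕ) : 0 < qgTerm q n 2 := by
  unfold qgTerm
  obtain ⟨t, ht, e1, e2, e3⟩ := qg_exps q hq0 hq1 n
  have hn : (0 : ℝ) < (n : ℝ) + 1 := by positivity
  have h1 := qg_pow_lt q hq0 hq1 n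
  rw [e3, e1]
  rw [e2] at h1 ⊢
  have e4 : Real.exp (-(t * 2)) = Real.exp (-t) * Real.exp (-t) := by
    rw [← Real.exp_add]; ring_nf
  rw [e4]
  have h2 : 0 < 1 - Real.exp (-t) := by linarith
  have h3 : t + 1 < Real.exp t := Real.add_one_lt_exp ht.ne'
  have h4 : Real.exp (-t) * Real.exp t = 1 := by rw [← Real.exp_add]; simp
  have h0 := Real.exp_pos (-t)
  have hk : 0 < 2 * (Real.exp (-t) * ((1 - Real.exp (-t)) - t * Real.exp (-t))) := by
    have : 0 < (1 - Real.exp (-t)) - t * Real.exp (-t) := by nlinarith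
    positivity
  have := div_pos hk (mul_pos hn h2)
  refine this.trans_eq ?_
  field_simp
  ring

/-- f(x) = log Γ_q(x) + x ψ_q(x) is strictly increasing on (1,∞) with a
unique zero, which lies in (1,2). -/
theorem log_qGamma_add_mul_qDigamma_strictMono (q : ℝ) (hq0 : 0 < q) (hq1 : q < 1) :
    StrictMonoOn (fun x => Real.log (qGamma q x) + x * qDigamma q x) (Set.Ioi 1) ∧
    ∃ x₀ ∈ Set.Ioo (1 : ℝ) 2,
      Real.log (qGamma q x₀) + x₀ * qDigamma q x₀ = 0 ∧
      ∀ x ∈ Set.Ioi (1 : ℝ), Real.log (qGamma q x) + x * qDigamma q x = 0 → x = x₀ := by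
  have hS : ∀ x : ℝ, 1 ≤ x → HasSum (fun n => qgTerm q n x)
      (Real.log (qGamma q x) + x * qDigamma q x) :=
    fun x hx => qg_hasSum q hq0 hq1 x (by linarith)
  have hmono : StrictMonoOn (fun x => Real.log (qGamma q x) + x * qDigamma q x) (Set.Ioi 1) := by
    intro x hx y hy hxy
    have hx' : (1 : ℝ) ≤ x := le_of_lt hx
    have hy' : (1 : ℝ) ≤ y := le_of_lt hy
    exact hasSum_lt (i := 0) (fun n => (qg_strictMono q hq0 hq1 n hx' hy' hxy).le)
      (qg_strictMono q hq0 hq1 0 hx' hy' hxy) (hS x hx') (hS y hy')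
  refine ⟨hmono, ?_⟩
  have hcont : ContinuousOn (fun x => Real.log (qGamma q x) + x * qDigamma q x)
      (Set.Icc 1 2) := by
    have hc : ContinuousOn (fun x => ∑' n, qgTerm q n x) (Set.Icc 1 2) := by
      refine continuousOn_tsum
        (fun n x _ => (qg_hasDeriv q hq0 n x).continuousAt.continuousWithinAt)
        ((hS 1 le_rfl).summable.abs.add (hS 2 (by norm_num)).summable.abs) ?_
      intro n x hx
      have ha := (qg_strictMono q hq0 hq1 n).monotoneOn (Set.mem_Ici.2 le_rfl)
        (Set.mem_Ici.2 hx.1) hx.1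
      have hb := (qg_strictMono q hq0 hq1 n).monotoneOn (Set.mem_Ici.2 hx.1)
        (Set.mem_Ici.2 (by norm_num)) hx.2
      rw [Real.norm_eq_abs, abs_le]
      constructor
      · linarith [neg_abs_le (qgTerm q n 1), abs_nonneg (qgTerm q n 2)]
      · linarith [le_abs_self (qgTerm q n 2), abs_nonneg (qgTerm q n 1)]
    exact hc.congr (fun x hx => (hS x hx.1).tsum_eq.symm)
  have h1 : Real.log (qGamma q 1) + 1 * qDigamma q 1 < 0 :=
    hasSum_lt (i := 0) (fun n => (qg_one q hq0 hq1 n).le) (qg_one q hq0 hq1 0)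
      (hS 1 le_rfl) hasSum_zero
  have h2 : 0 < Real.log (qGamma q 2) + 2 * qDigamma q 2 :=
    hasSum_lt (i := 0) (fun n => (qg_two q hq0 hq1 n).le) (qg_two q hq0 hq1 0)
      hasSum_zero (hS 2 (by norm_num))
  obtain ⟨x₀, hx₀, hz⟩ := intermediate_value_Ioo (by norm_num : (1 : ℝ) ≤ 2) hcont ⟨h1, h2⟩
  refine ⟨x₀, hx₀, hz, fun x hx hxz => ?_⟩
  exact hmono.injOn hx hx₀.1 (hxz.trans hz.symm)
end

section
/- Let 0<q<1. (a) The function (Γ_q(x))^{1/x} is strictly log-convex on (0,1], i.e. x ↦ (1/x)·log Γ_q(x) is strictly convex on (0,1]. (b) The function (Γ_q(x))^{x} is strictly log-convex on [1,∞), i.e. x ↦ x·log Γ_q(x) is strictly convex on [1,∞). -/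
open Real

noncomputable def qT (q : ℝ) (k : ℕ) (x : ℝ) (n : ℕ) : ℝ :=
  (((n : ℝ) + 1) * (1 - q ^ (n + 1)))⁻¹ * ((n : ℝ) + 1) ^ k * (q ^ x) ^ (n + 1)

theorem qT_pos {q : ℝ} (hq0 : 0 < q) (hq1 : q < 1) (k : ℕ) (x : ℝ) (n : ℕ) : 0 < qT q k x n := by
  have h1 : q ^ (n + 1) < 1 := pow_lt_one₀ hq0.le hq1 (by omega)
  have h2 : 0 < 1 - q ^ (n + 1) := by linarith
  have h3 : 0 < q ^ x := Real.rpow_pos_of_pos hq0 x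
  unfold qT
  positivity

theorem qT_summable {q : ℝ} (hq0 : 0 < q) (hq1 : q < 1) (k : ℕ) {x : ℝ} (hx : 0 < x) :
    Summable (qT q k x) := by
  have hr0 : 0 < q ^ x := Real.rpow_pos_of_pos hq0 x
  have hr1 : q ^ x < 1 := Real.rpow_lt_one hq0.le hq1 hx
  have hs : Summable (fun n : ℕ => ((n : ℝ)) ^ k * (q ^ x) ^ n) :=
    summable_pow_mul_geometric_of_norm_lt_one k (by rw [Real.norm_of_nonneg hr0.le]; exact hr1)
  have hs1 := ((summable_nat_add_iff 1).2 hs).mul_left ((1 - q)⁻¹)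
  refine Summable.of_nonneg_of_le (fun n => (qT_pos hq0 hq1 k x n).le) (fun n => ?_) hs1
  have h1 : q ^ (n + 1) ≤ q := pow_le_of_le_one hq0.le hq1.le (by omega)
  have h2 : 0 < 1 - q := by linarith
  unfold qT
  push_cast
  rw [mul_assoc]
  refine mul_le_mul_of_nonneg_right ?_ (by positivity)
  apply inv_anti₀ h2
  have : (0 : ℝ) ≤ n := Nat.cast_nonneg n
  nlinarith

theorem qT_deriv {q : ℝ} (hq0 : 0 < q) (k : ℕ) (x : ℝ) (n : ℕ) :
    HasDerivAt (fun y => qT q k y n) (Real.log q * qT q (k + 1) x n) x := by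
  have h := ((Real.hasStrictDerivAt_const_rpow hq0 x).hasDerivAt.pow (n + 1)).const_mul
    ((((n : ℝ) + 1) * (1 - q ^ (n + 1)))⁻¹ * ((n : ℝ) + 1) ^ k)
  unfold qT
  refine h.congr_deriv ?_
  simp only [Nat.add_sub_cancel]
  push_cast
  ring

theorem qT_anti {q : ℝ} (hq0 : 0 < q) (hq1 : q < 1) (k : ℕ) {x y : ℝ} (h : x ≤ y) (n : ℕ) :
    qT q k y n ≤ qT q k x n := by
  have h1 : q ^ (n + 1) < 1 := pow_lt_one₀ hq0.le hq1 (by omega)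
  have h2 : 0 < 1 - q ^ (n + 1) := by linarith
  have h4 : 0 < q ^ y := Real.rpow_pos_of_pos hq0 y
  have h3 : q ^ y ≤ q ^ x := Real.rpow_le_rpow_of_exponent_ge hq0 hq1.le h
  unfold qT
  gcongr

noncomputable def qS (q : ℝ) (k : ℕ) (x : ℝ) : ℝ := ∑' n, qT q k x n

theorem qS_pos {q : ℝ} (hq0 : 0 < q) (hq1 : q < 1) (k : ℕ) {x : ℝ} (hx : 0 < x) :
    0 < qS q k x :=
  (qT_summable hq0 hq1 k hx).tsum_pos (fun n => (qT_pos hq0 hq1 k x n).le) 0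
    (qT_pos hq0 hq1 k x 0)

theorem qS_deriv {q : ℝ} (hq0 : 0 < q) (hq1 : q < 1) (k : ℕ) {x : ℝ} (hx : 0 < x) :
    HasDerivAt (qS q k) (Real.log q * qS q (k + 1) x) x := by
  have hx2 : 0 < x / 2 := by linarith
  have h := hasDerivAt_tsum_of_isPreconnected
    (u := fun n => |Real.log q| * qT q (k + 1) (x / 2) n)
    (g := fun n y => qT q k y n) (g' := fun n y => Real.log q * qT q (k + 1) y n)
    (t := Set.Ioi (x / 2)) (y₀ := x) (y := x)
    ((qT_summable hq0 hq1 (k + 1) hx2).mul_left _) isOpen_Ioi isPreconnected_Ioi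
    (fun n y _ => qT_deriv hq0 k y n)
    (fun n y hy => by
      rw [norm_mul, Real.norm_eq_abs, Real.norm_of_nonneg (qT_pos hq0 hq1 _ _ _).le]
      exact mul_le_mul_of_nonneg_left (qT_anti hq0 hq1 _ (le_of_lt hy) n) (abs_nonneg _))
    (by simp only [Set.mem_Ioi]; linarith) (qT_summable hq0 hq1 k hx)
    (by simp only [Set.mem_Ioi]; linarith)
  rw [tsum_mul_left] at h
  exact h

/-- interchange of sums -/
theorem qS_log {q : ℝ} (hq0 : 0 < q) (hq1 : q < 1) {x : ℝ} (hx : 0 < x) :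
    HasSum (fun i : ℕ => -Real.log (1 - q ^ (x + (i : ℝ)))) (qS q 0 x) := by
  let g : ℕ × ℕ → ℝ := fun p => (q ^ (x + (p.2 : ℝ))) ^ (p.1 + 1) / ((p.1 : ℝ) + 1)
  have hg0 : 0 ≤ g := fun p => by
    have := Real.rpow_pos_of_pos hq0 (x + (p.2 : ℝ))
    simp only [g, Pi.zero_apply]
    positivity
  have hrow : ∀ n : ℕ, HasSum (fun i : ℕ => g (n, i)) (qT q 0 x n) := by
    intro n
    have h1 : q ^ (n + 1) < 1 := pow_lt_one₀ hq0.le hq1 (by omega)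
    have h := (hasSum_geometric_of_lt_one (pow_nonneg hq0.le (n + 1)) h1).mul_left
      ((q ^ x) ^ (n + 1) / ((n : ℝ) + 1))
    have e1 : (fun i : ℕ => g (n, i)) =
        fun i : ℕ => (q ^ x) ^ (n + 1) / ((n : ℝ) + 1) * (q ^ (n + 1)) ^ i := by
      funext i
      simp only [g]
      rw [Real.rpow_add hq0, Real.rpow_natCast, mul_pow, ← pow_mul, ← pow_mul, mul_comm i]
      ring
    have e2 : qT q 0 x n = (q ^ x) ^ (n + 1) / ((n : ℝ) + 1) * (1 - q ^ (n + 1))⁻¹ := by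
      unfold qT
      rw [mul_inv]
      ring
    rw [e1, e2]
    exact h
  have hsum : Summable g := by
    rw [summable_prod_of_nonneg hg0]
    refine ⟨fun n => (hrow n).summable, ?_⟩
    have : (fun n => ∑' i, g (n, i)) = qT q 0 x := funext fun n => (hrow n).tsum_eq
    rw [this]
    exact qT_summable hq0 hq1 0 hx
  have htot : HasSum g (qS q 0 x) := by
    have h1 := hsum.hasSum.prod_fiberwise hrow
    have h2 : qS q 0 x = ∑' p, g p := h1.tsum_eq
    rw [h2]
    exact hsum.hasSum
  have hswap : HasSum (fun p : ℕ × ℕ => g p.swap) (qS q 0 x) :=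
    (Equiv.hasSum_iff (f := g) (Equiv.prodComm ℕ ℕ)).2 htot
  have hcol : ∀ i : ℕ, HasSum (fun n : ℕ => g ((i, n) : ℕ × ℕ).swap)
      (-Real.log (1 - q ^ (x + (i : ℝ)))) := by
    intro i
    have hp : 0 < q ^ (x + (i : ℝ)) := Real.rpow_pos_of_pos hq0 _
    have hl : q ^ (x + (i : ℝ)) < 1 := Real.rpow_lt_one hq0.le hq1 (by positivity)
    have h := Real.hasSum_pow_div_log_of_abs_lt_one (x := q ^ (x + (i : ℝ)))
      (by rw [abs_of_pos hp]; exact hl)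
    simp only [g, Prod.swap]
    exact h
  exact HasSum.prod_fiberwise hswap hcol

theorem q_tprod {q : ℝ} (hq0 : 0 < q) (hq1 : q < 1) {x : ℝ} (hx : 0 < x) :
    ∏' i : ℕ, (1 - q ^ (x + (i : ℝ))) = Real.exp (-qS q 0 x) := by
  have h := (qS_log hq0 hq1 hx).neg
  simp only [neg_neg] at h
  rw [← h.tsum_eq]
  symm
  apply Real.rexp_tsum_eq_tprod _ h.summable
  intro i
  have hl : q ^ (x + (i : ℝ)) < 1 := Real.rpow_lt_one hq0.le hq1 (by positivity)
  linarith

theorem qlogGamma {q : ℝ} (hq0 : 0 < q) (hq1 : q < 1) {x : ℝ} (hx : 0 < x) :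
    Real.log (qGamma q x) = qS q 0 x - qS q 0 1 + (1 - x) * Real.log (1 - q) := by
  have h1 : ∏' i : ℕ, (1 - q ^ (i + 1)) = Real.exp (-qS q 0 1) := by
    rw [← q_tprod hq0 hq1 one_pos]
    congr 1
    funext i
    rw [← Real.rpow_natCast]
    push_cast
    rw [add_comm]
  have h2 : 0 < 1 - q := by linarith
  unfold qGamma
  rw [h1, q_tprod hq0 hq1 hx, Real.log_mul (by positivity) (by positivity),
    Real.log_div (by positivity) (by positivity), Real.log_exp, Real.log_exp, Real.log_rpow h2]
  ring

theorem qS_shift {q : ℝ} (hq0 : 0 < q) (hq1 : q < 1) {x : ℝ} (hx : 0 < x) :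
    qS q 0 x - qS q 0 (x + 1) = -Real.log (1 - q ^ x) := by
  have h1 := qS_log hq0 hq1 hx
  have h2 := (qS_log hq0 hq1 (x := x + 1) (by linarith)).tsum_eq
  have h3 := h1.summable.tsum_eq_zero_add
  rw [h1.tsum_eq] at h3
  rw [h3, ← h2]
  simp only [Nat.cast_zero, add_zero]
  have : ∀ i : ℕ, x + ((i + 1 : ℕ) : ℝ) = x + 1 + i := fun i => by push_cast; ring
  simp only [this]
  ring

theorem strictConvex_aux {D : Set ℝ} (hD : Convex ℝ D) (hpos : ∀ x ∈ D, 0 < x) {F F1 F2 : ℝ → ℝ}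
    (h1 : ∀ x, 0 < x → HasDerivAt F (F1 x) x) (h2 : ∀ x, 0 < x → HasDerivAt F1 (F2 x) x)
    (h : ∀ x ∈ interior D, 0 < F2 x) : StrictConvexOn ℝ D F := by
  refine strictConvexOn_of_deriv2_pos hD
    (fun x hx => (h1 x (hpos x hx)).continuousAt.continuousWithinAt) (fun x hx => ?_)
  have hx0 := hpos x (interior_subset hx)
  have he : deriv F =ᶠ[nhds x] F1 := by
    filter_upwards [lt_mem_nhds hx0] with y hy using (h1 y hy).deriv
  simp only [Function.iterate_succ, Function.iterate_zero, Function.comp_apply, id]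
  rw [he.deriv_eq, (h2 x hx0).deriv]
  exact h x hx

/-- Abstract form of the argument. -/
theorem abstract_aux {f f1 f2 f3 : ℝ → ℝ}
    (d0 : ∀ x, 0 < x → HasDerivAt f (f1 x) x)
    (d1 : ∀ x, 0 < x → HasDerivAt f1 (f2 x) x)
    (d2 : ∀ x, 0 < x → HasDerivAt f2 (f3 x) x)
    (p2 : ∀ x, 0 < x → 0 < f2 x) (p3 : ∀ x, 0 < x → f3 x < 0)
    (e1 : f 1 = 0) (e2 : f 2 = 0) (hs : ∀ x, 1 ≤ x → f x ≤ f (x + 1)) :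
    StrictConvexOn ℝ (Set.Ioc 0 1) (fun x => (1 / x) * f x) ∧
    StrictConvexOn ℝ (Set.Ici 1) (fun x => x * f x) := by
  have mvt : ∀ {g g' : ℝ → ℝ}, (∀ x, 0 < x → HasDerivAt g (g' x) x) → ∀ a b, 0 < a → a < b →
      ∃ c, a < c ∧ c < b ∧ g b - g a = g' c * (b - a) := by
    intro g g' hg a b ha hab
    obtain ⟨c, hc, h⟩ := exists_hasDerivAt_eq_slope g g' hab
      (fun x hx => (hg x (by linarith [hx.1])).continuousAt.continuousWithinAt)
      (fun x hx => hg x (by linarith [hx.1]))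
    refine ⟨c, hc.1, hc.2, ?_⟩
    rw [h]
    have : b - a ≠ 0 := by linarith
    field_simp
  constructor
  · have hf1 : f1 1 < 0 := by
      obtain ⟨c, hc1, hc2, hc⟩ := mvt d0 1 2 one_pos (by norm_num)
      obtain ⟨e, he1, he2, he⟩ := mvt d1 1 c one_pos hc1
      have := mul_pos (p2 e (by linarith)) (sub_pos.2 hc1)
      rw [e1, e2] at hc
      linarith
    have key : ∀ x, 0 < x → x < 1 → 0 < x ^ 2 * f2 x - 2 * x * f1 x + 2 * f x := by
      intro x hx hx1
      have hd : ∀ x, 0 < x → HasDerivAt (fun x => x ^ 2 * f2 x - 2 * x * f1 x + 2 * f x)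
          (x ^ 2 * f3 x) x := by
        intro x hx
        have h := (((hasDerivAt_pow 2 x).mul (d2 x hx)).sub
          (((hasDerivAt_id x).const_mul 2).mul (d1 x hx))).add ((d0 x hx).const_mul 2)
        refine h.congr_deriv ?_
        simp
        ring
      obtain ⟨c, hc1, hc2, hc⟩ := mvt hd x 1 hx hx1
      have h0 : 0 < c := by linarith
      have := mul_pos (mul_pos (pow_pos h0 2) (neg_pos.2 (p3 c h0))) (sub_pos.2 hx1)
      have := p2 1 one_pos
      simp only [e1] at hc
      nlinarith
    refine strictConvex_aux (convex_Ioc 0 1) (fun x hx => hx.1)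
      (F1 := fun x => (x * f1 x - f x) / x ^ 2)
      (F2 := fun x => (x ^ 2 * f2 x - 2 * x * f1 x + 2 * f x) / x ^ 3) ?_ ?_ ?_
    · intro x hx
      have h := (d0 x hx).div (hasDerivAt_id x) hx.ne'
      have e : (fun x => (1 / x) * f x) = fun x => f x / id x := by
        funext y; simp only [id]; ring
      rw [e]
      refine h.congr_deriv ?_
      simp only [id]
      ring
    · intro x hx
      have h := (((hasDerivAt_id x).mul (d1 x hx)).sub (d0 x hx)).div (hasDerivAt_pow 2 x)
        (by positivity)
      refine h.congr_deriv ?_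
      simp
      field_simp
      ring
    · intro x hx
      rw [interior_Ioc] at hx
      exact div_pos (key x hx.1 hx.2) (pow_pos hx.1 3)
  · refine strictConvex_aux (convex_Ici 1) (fun x hx => lt_of_lt_of_le one_pos hx)
      (F1 := fun x => f x + x * f1 x) (F2 := fun x => 2 * f1 x + x * f2 x) ?_ ?_ ?_
    · intro x hx
      have h := (hasDerivAt_id x).mul (d0 x hx)
      refine h.congr_deriv ?_
      simp
    · intro x hx
      have h := (d0 x hx).add ((hasDerivAt_id x).mul (d1 x hx))
      refine h.congr_deriv ?_
      simp
      ring
    · intro x hx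
      rw [interior_Ici] at hx
      have hx1 : 1 < x := hx
      have hx0 : 0 < x := by linarith
      have hd : ∀ t, 0 < t → HasDerivAt (fun t => f t - f1 x * t - f2 x / 2 * (t - x) ^ 2)
          (f1 t - f1 x - f2 x * (t - x)) t := by
        intro t ht
        have h := ((d0 t ht).sub ((hasDerivAt_id t).const_mul (f1 x))).sub
          ((((hasDerivAt_id t).sub_const x).pow 2).const_mul (f2 x / 2))
        refine h.congr_deriv ?_
        simp
        ring
      obtain ⟨c, hc1, hc2, hc⟩ := mvt hd x (x + 1) hx0 (by linarith)
      obtain ⟨e, he1, he2, he⟩ := mvt d1 x c hx0 hc1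
      obtain ⟨g, hg1, hg2, hg⟩ := mvt d2 x e hx0 he1
      have a1 := mul_pos (neg_pos.2 (p3 g (by linarith))) (sub_pos.2 he1)
      have a2 : 0 < (f2 x - f2 e) * (c - x) := mul_pos (by linarith) (by linarith)
      have a3 := hs x hx1.le
      have a4 := mul_pos (sub_pos.2 hx1) (p2 x hx0)
      ring_nf at hc a2 a3 a4 he ⊢
      nlinarith

/-- (Γ_q(x))^{1/x} is strictly log-convex on (0,1] and (Γ_q(x))^x is
strictly log-convex on [1,∞). -/
theorem qGamma_pow_strictConvex (q : ℝ) (hq0 : 0 < q) (hq1 : q < 1) :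
    StrictConvexOn ℝ (Set.Ioc 0 1) (fun x => (1 / x) * Real.log (qGamma q x)) ∧
    StrictConvexOn ℝ (Set.Ici 1) (fun x => x * Real.log (qGamma q x)) := by
  have hL : Real.log q < 0 := Real.log_neg hq0 hq1
  have main := abstract_aux
    (f := fun x => qS q 0 x - qS q 0 1 + (1 - x) * Real.log (1 - q))
    (f1 := fun x => Real.log q * qS q 1 x - Real.log (1 - q))
    (f2 := fun x => Real.log q * (Real.log q * qS q 2 x))
    (f3 := fun x => Real.log q * (Real.log q * (Real.log q * qS q 3 x)))
    (fun x hx => by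
      have h := ((qS_deriv hq0 hq1 0 hx).sub_const (qS q 0 1)).add
        (((hasDerivAt_id x).const_sub 1).mul_const (Real.log (1 - q)))
      refine h.congr_deriv ?_
      ring)
    (fun x hx => ((qS_deriv hq0 hq1 1 hx).const_mul _).sub_const _)
    (fun x hx => ((qS_deriv hq0 hq1 2 hx).const_mul _).const_mul _)
    (fun x hx => mul_pos_of_neg_of_neg hL (mul_neg_of_neg_of_pos hL (qS_pos hq0 hq1 2 hx)))
    (fun x hx => mul_neg_of_neg_of_pos hL
      (mul_pos_of_neg_of_neg hL (mul_neg_of_neg_of_pos hL (qS_pos hq0 hq1 3 hx))))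
    (by ring)
    (by
      have h := qS_shift hq0 hq1 one_pos
      rw [Real.rpow_one] at h
      norm_num at h ⊢
      linarith)
    (fun x hx => by
      have h := qS_shift hq0 hq1 (x := x) (by linarith)
      have h1 : q ^ x ≤ q := by
        simpa using Real.rpow_le_rpow_of_exponent_ge hq0 hq1.le hx
      have h2 : Real.log (1 - q) ≤ Real.log (1 - q ^ x) :=
        Real.log_le_log (by linarith) (by linarith)
      linarith)
  refine ⟨main.1.congr fun x hx => ?_, main.2.congr fun x hx => ?_⟩
  · simp only [qlogGamma hq0 hq1 hx.1]
  · simp only [qlogGamma hq0 hq1 (lt_of_lt_of_le one_pos hx)]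
end

section
/- Let 0<q<1. For every x ∈ (0,1/2], Γ_q(1-x)/Γ_q(x) ≤ Γ_q((1-x)/x), with equality if and only if x = 1/2. -/
open Real

noncomputable def qL (q x : ℝ) : ℝ := ∑' i : ℕ, Real.log (1 - q ^ (x + (i : ℝ)))

noncomputable def qF (q x : ℝ) : ℝ := qL q 1 - qL q x + (1 - x) * Real.log (1 - q)

lemma q_pos (q : ℝ) (hq0 : 0 < q) (hq1 : q < 1) (x : ℝ) (hx : 0 < x) : 0 < 1 - q ^ x := by
  have := Real.rpow_lt_one hq0.le hq1 hx
  linarith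

lemma qL_summable (q : ℝ) (hq0 : 0 < q) (hq1 : q < 1) (x : ℝ) :
    Summable (fun i : ℕ => Real.log (1 - q ^ (x + (i : ℝ)))) := by
  have h : Summable (fun i : ℕ => -(q ^ (x + (i : ℝ)))) := by
    have : ∀ i : ℕ, q ^ (x + (i : ℝ)) = q ^ x * q ^ i := fun i => by
      rw [Real.rpow_add hq0, Real.rpow_natCast]
    simp only [this]
    exact ((summable_geometric_of_lt_one hq0.le hq1).mul_left _).neg
  simpa [sub_eq_add_neg] using Real.summable_log_one_add_of_summable h

lemma qL_exp (q : ℝ) (hq0 : 0 < q) (hq1 : q < 1) (x : ℝ) (hx : 0 < x) :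
    Real.exp (qL q x) = ∏' i : ℕ, (1 - q ^ (x + (i : ℝ))) :=
  Real.rexp_tsum_eq_tprod (fun i => q_pos q hq0 hq1 _ (by positivity)) (qL_summable q hq0 hq1 x)

lemma qGamma_eq (q : ℝ) (hq0 : 0 < q) (hq1 : q < 1) (x : ℝ) (hx : 0 < x) :
    qGamma q x = Real.exp (qF q x) := by
  have h1 : (∏' i : ℕ, (1 - q ^ (i + 1))) = Real.exp (qL q 1) := by
    rw [qL_exp q hq0 hq1 1 one_pos]
    congr 1
    ext i
    rw [← Real.rpow_natCast]
    push_cast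
    rw [add_comm]
  unfold qGamma qF
  rw [h1, ← qL_exp q hq0 hq1 x hx, Real.exp_add, Real.exp_sub,
    Real.rpow_def_of_pos (by linarith : 0 < 1 - q), mul_comm (1 - x)]

lemma qL_succ (q : ℝ) (hq0 : 0 < q) (hq1 : q < 1) (x : ℝ) :
    qL q x = Real.log (1 - q ^ x) + qL q (x + 1) := by
  unfold qL
  rw [(qL_summable q hq0 hq1 x).tsum_eq_zero_add]
  simp only [Nat.cast_zero, add_zero, Nat.cast_add, Nat.cast_one]
  congr 2
  ext i
  rw [add_assoc, add_comm 1 (i : ℝ)]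

lemma log_concave (q : ℝ) (hq0 : 0 < q) (hq1 : q < 1) (x y a b : ℝ) (hx : 0 < x) (hy : 0 < y)
    (ha : 0 ≤ a) (hb : 0 ≤ b) (hab : a + b = 1) :
    a * Real.log (1 - q ^ x) + b * Real.log (1 - q ^ y) ≤ Real.log (1 - q ^ (a * x + b * y)) := by
  have h1 := q_pos q hq0 hq1 x hx
  have h2 := q_pos q hq0 hq1 y hy
  have h3 := strictConcaveOn_log_Ioi.concaveOn.2 h1 h2 ha hb hab
  have h4 := convexOn_exp.2 (Set.mem_univ (Real.log q * x)) (Set.mem_univ (Real.log q * y)) ha hb hab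
  have h5 : 0 < a • (1 - q ^ x) + b • (1 - q ^ y) :=
    (convex_Ioi (0 : ℝ)) h1 h2 ha hb hab
  simp only [smul_eq_mul] at h3 h4 h5
  refine h3.trans (Real.log_le_log h5 ?_)
  rw [Real.rpow_def_of_pos hq0, Real.rpow_def_of_pos hq0, Real.rpow_def_of_pos hq0]
  have : Real.log q * (a * x + b * y) = a * (Real.log q * x) + b * (Real.log q * y) := by ring
  rw [this]
  nlinarith

lemma qF_convex (q : ℝ) (hq0 : 0 < q) (hq1 : q < 1) : ConvexOn ℝ (Set.Ioi 0) (qF q) := by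
  refine ⟨convex_Ioi 0, ?_⟩
  intro x hx y hy a b ha hb hab
  have hx : 0 < x := hx
  have hy : 0 < y := hy
  have key : a * qL q x + b * qL q y ≤ qL q (a * x + b * y) := by
    unfold qL
    rw [← tsum_mul_left, ← tsum_mul_left, ← Summable.tsum_add
      ((qL_summable q hq0 hq1 x).mul_left a) ((qL_summable q hq0 hq1 y).mul_left b)]
    refine Summable.tsum_le_tsum (fun i => ?_)
      (((qL_summable q hq0 hq1 x).mul_left a).add ((qL_summable q hq0 hq1 y).mul_left b))
      (qL_summable q hq0 hq1 _)
    have := log_concave q hq0 hq1 (x + i) (y + i) a b (by positivity) (by positivity) ha hb hab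
    have e : a * (x + i) + b * (y + i) = a * x + b * y + i := by
      linear_combination (i : ℝ) * hab
    rwa [e] at this
  simp only [smul_eq_mul, qF]
  have hb' : b = 1 - a := by linarith
  subst hb'
  linarith

lemma bracket_lt (q : ℝ) (hq0 : 0 < q) (hq1 : q < 1) (x y : ℝ) (hx : 0 < x) (hx1 : x < 1)
    (hy : 1 < y) : (1 - q ^ x) * (1 - q ^ y) < (1 - q) * (1 - q ^ (x * y)) := by
  have hr0 : 0 < q ^ y := Real.rpow_pos_of_pos hq0 y
  have hr : q ^ y < q := by
    simpa using Real.rpow_lt_rpow_of_exponent_gt hq0 hq1 hy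
  have h := (Real.strictConcaveOn_rpow hx hx1).slope_anti_adjacent
    (x := q ^ y) (y := q) (z := 1) hr0.le (Set.mem_Ici.2 zero_le_one) hr hq1
  rw [div_lt_div_iff₀ (by linarith) (by linarith), ← Real.rpow_mul hq0.le, Real.one_rpow,
    mul_comm y x] at h
  nlinarith

lemma qF_lt (q : ℝ) (hq0 : 0 < q) (hq1 : q < 1) (x : ℝ) (hx : 0 < x) (hx2 : x < 1 / 2) :
    qF q (1 - x) - qF q x < qF q ((1 - x) / x) := by
  set y := (1 - x) / x with hy
  have hxy : x * y = 1 - x := by rw [hy]; field_simp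
  have hy1 : 1 < y := by rw [hy, lt_div_iff₀ hx]; linarith
  have hB := bracket_lt q hq0 hq1 x y hx (by linarith) hy1
  rw [hxy] at hB
  have p1 := q_pos q hq0 hq1 x hx
  have p2 := q_pos q hq0 hq1 y (by linarith)
  have p3 := q_pos q hq0 hq1 (1 - x) (by linarith)
  have p4 : 0 < 1 - q := by linarith
  have hlog := Real.log_lt_log (mul_pos p1 p2) hB
  rw [Real.log_mul p1.ne' p2.ne', Real.log_mul p4.ne' p3.ne'] at hlog
  have f1 : qF q 1 = 0 := by simp [qF]
  have s1 := qL_succ q hq0 hq1 1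
  have sx := qL_succ q hq0 hq1 x
  have sy := qL_succ q hq0 hq1 y
  have sz := qL_succ q hq0 hq1 (1 - x)
  rw [Real.rpow_one] at s1
  have f2 : qF q (1 + 1) = 0 := by simp only [qF]; rw [s1]; ring
  have C := qF_convex q hq0 hq1
  -- slopes
  have c1 : 0 ≤ qF q (y + 1) := by
    have h := C.slope_mono_adjacent (x := 1) (y := 1 + 1) (z := y + 1)
      (by simp) (by simp; linarith) (by norm_num) (by linarith)
    rw [f1, f2, div_le_div_iff₀ (by norm_num) (by linarith)] at h
    linarith
  have c2 : qF q (1 - x + 1) - qF q (x + 1) ≤ x * qF q (y + 1) := by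
    have h1 := C.slope_mono_adjacent (x := x + 1) (y := 1 - x + 1) (z := 1 + 1)
      (by simp; linarith) (by simp) (by linarith) (by linarith)
    have h2 := C.slope_mono_adjacent (x := 1 - x + 1) (y := 1 + 1) (z := y + 1)
      (by simp; linarith) (by simp; linarith) (by linarith) (by linarith)
    have h := h1.trans h2
    rw [f2, div_le_div_iff₀ (by linarith) (by linarith)] at h
    have e : y + 1 - (1 + 1) = (1 - x + 1 - (x + 1)) / x := by
      rw [hy]; field_simp; ring
    have hpos : 0 < 1 - x + 1 - (x + 1) := by linarith
    rw [e] at h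
    have h' : (qF q (1 - x + 1) - qF q (x + 1)) / x ≤ qF q (y + 1) := by
      refine le_of_mul_le_mul_right ?_ hpos
      calc _ = (qF q (1 - x + 1) - qF q (x + 1)) * ((1 - x + 1 - (x + 1)) / x) := by ring
        _ ≤ _ := by simpa using h
    rw [div_le_iff₀ hx] at h'
    linarith
  have c3 : x * qF q (y + 1) ≤ qF q (y + 1) := by nlinarith
  have c4 := c2.trans c3
  simp only [qF] at c4 ⊢
  linarith

/-- Γ_q(1-x)/Γ_q(x) ≤ Γ_q((1-x)/x) on (0,1/2], with equality iff x = 1/2. -/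
theorem qGamma_ratio_le (q : ℝ) (hq0 : 0 < q) (hq1 : q < 1)
    (x : ℝ) (hx : x ∈ Set.Ioc (0 : ℝ) (1 / 2)) :
    qGamma q (1 - x) / qGamma q x ≤ qGamma q ((1 - x) / x) ∧
    (qGamma q (1 - x) / qGamma q x = qGamma q ((1 - x) / x) ↔ x = 1 / 2) := by
  obtain ⟨h0, h1⟩ := hx
  have hp : 0 < 1 - x := by linarith
  rw [qGamma_eq q hq0 hq1 _ hp, qGamma_eq q hq0 hq1 _ h0, qGamma_eq q hq0 hq1 _ (div_pos hp h0),
    ← Real.exp_sub]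
  rcases h1.lt_or_eq with h | h
  · have := Real.exp_lt_exp.2 (qF_lt q hq0 hq1 x h0 h)
    exact ⟨this.le, fun e => absurd e this.ne, fun e => absurd e h.ne⟩
  · subst h
    have e1 : (1 : ℝ) - 1 / 2 = 1 / 2 := by norm_num
    have e2 : (1 / 2 : ℝ) / (1 / 2) = 1 := by norm_num
    have f1 : qF q 1 = 0 := by simp [qF]
    rw [e1, e2, f1, sub_self]
    simp
end
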